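/- For every integer n ≥ 1 and every complex q with 0 < |q| < 1, ∑_{j=0}^{n} (-1;q)_j (-1)^j q^{j - jn} / (q;q)_j = − [ (1 + q^n) / (1 − q^n) ] · ∑_{m=0}^{n-1} (-1;q)_m (-1)^m q^{-mn} / (q;q)_m. -/

import Mathlib

open scoped BigOperators

/-- The finite q-Pochhammer symbol `(a;q)_n`. -/
noncomputable def qPoch (a q : ℂ) (n : ℕ) : ℂ := ∏ k ∈ Finset.range n, (1 - a * q ^ k)

lemma qPoch_succ (a q : ℂ) (n : ℕ) : qPoch a q (n + 1) = qPoch a q n * (1 - a * q ^ n) :=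
  Finset.prod_range_succ _ _

lemma qPoch_self_ne_zero {q : ℂ} (hq : ∀ k : ℕ, 1 - q ^ (k + 1) ≠ 0) (n : ℕ) :
    qPoch q q n ≠ 0 := by
  refine Finset.prod_ne_zero_iff.mpr fun k _ => ?_
  rw [← pow_succ']
  exact hq k

/-- The functional equation relating partial sums of `∑ (-1;q)_j (-z)^j / (q;q)_j` at `q * z`
and at `z`. -/
lemma one_sub_mul_sum_qPoch {q : ℂ} (hq : ∀ k : ℕ, 1 - q ^ (k + 1) ≠ 0) (z : ℂ) (n : ℕ) :
    (1 - z) * ∑ j ∈ Finset.range (n + 1), qPoch (-1) q j * (-1) ^ j * (q * z) ^ j / qPoch q q j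
      = (1 + z) * ∑ j ∈ Finset.range n, qPoch (-1) q j * (-1) ^ j * z ^ j / qPoch q q j
        + qPoch (-1) q n * (-1) ^ n * z ^ n / qPoch q q n * (1 - z * q ^ n) := by
  induction n with
  | zero => simp [qPoch]
  | succ n ih =>
    rw [Finset.sum_range_succ, mul_add, ih, Finset.sum_range_succ, qPoch_succ, qPoch_succ,
      ← pow_succ']
    have h₁ := qPoch_self_ne_zero hq n
    have h₂ := hq n
    field_simp
    ring

theorem finite_fine_identity (n : ℕ) (hn : 1 ≤ n) (q : ℂ) (hq0 : 0 < ‖q‖)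
    (hq1 : ‖q‖ < 1) :
    ∑ j ∈ Finset.range (n + 1),
        qPoch (-1) q j * (-1) ^ j * q ^ ((j : ℤ) - (j : ℤ) * (n : ℤ)) / qPoch q q j
      = -((1 + q ^ n) / (1 - q ^ n)) *
          ∑ m ∈ Finset.range n,
            qPoch (-1) q m * (-1) ^ m * q ^ (-((m : ℤ) * (n : ℤ))) / qPoch q q m := by
  have hq : q ≠ 0 := norm_pos_iff.mp hq0
  have hpow (k : ℕ) : 1 - q ^ (k + 1) ≠ 0 := fun h => by
    have h₁ : ‖q‖ ^ (k + 1) = 1 := by rw [← norm_pow, ← sub_eq_zero.mp h, norm_one]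
    exact (pow_lt_one₀ hq0.le hq1 k.succ_ne_zero).ne h₁
  have hqn : 1 - q ^ n ≠ 0 := by
    obtain ⟨k, rfl⟩ := Nat.exists_eq_add_of_le' hn
    exact hpow k
  have hz (j : ℕ) : q ^ (-((j : ℤ) * (n : ℤ))) = ((q ^ n)⁻¹) ^ j := by
    rw [zpow_neg, mul_comm, zpow_mul, zpow_natCast, zpow_natCast, inv_pow]
  have hqz (j : ℕ) : q ^ ((j : ℤ) - (j : ℤ) * (n : ℤ)) = (q * (q ^ n)⁻¹) ^ j := by
    rw [sub_eq_add_neg, zpow_add₀ hq, hz, zpow_natCast, mul_pow]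
  simp only [hz, hqz]
  have key := one_sub_mul_sum_qPoch hpow (q ^ n)⁻¹ n
  have hn0 : q ^ n ≠ 0 := pow_ne_zero n hq
  rw [inv_mul_cancel₀ hn0, sub_self, mul_zero, add_zero] at key
  have solve {w L R : ℂ} (hw : w ≠ 0) (hw' : 1 - w ≠ 0)
      (h : (1 - w⁻¹) * L = (1 + w⁻¹) * R) : L = -((1 + w) / (1 - w)) * R := by
    field_simp at h ⊢
    linear_combination -h
  exact solve hn0 hqn key
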